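/- arXiv:1111.6822 — 2 statements merged into one kernel-verified Lean document; each statement's English description precedes it below -/
import Mathlib

section
/- Let P_X = (1 − γ)P_d + γP_c be a discrete-continuous mixture with 0 < γ ≤ 1, where P_d is a purely atomic probability measure on ℝ and P_c is a probability measure absolutely continuous with respect to Lebesgue measure. Let 0 < ε < 1 and 0 < R < γ. Then there is no sequence of matrices A_n ∈ ℝ^{⌊Rn⌋×n} and Borel measurable maps g_n: ℝ^{⌊Rn⌋} → ℝⁿ such that P(g_n(A_n X^n) = X^n) ≥ 1 − ε for all sufficiently large n, where X^n = (X_1, …, X_n) consists of n i.i.d. draws from P_X. -/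
open MeasureTheory Filter Real
open scoped NNReal ENNReal Topology

/-- Finite products of absolutely continuous σ-finite measures are absolutely continuous. -/
theorem pi_absolutelyContinuous {n : ℕ} {μ ν : Fin n → Measure ℝ}
    [∀ i, SigmaFinite (μ i)] [∀ i, SigmaFinite (ν i)] (h : ∀ i, μ i ≪ ν i) :
    Measure.pi μ ≪ Measure.pi ν := by
  induction n with
  | zero =>
    rw [Measure.pi_of_empty μ 0, Measure.pi_of_empty ν 0]
  | succ n ih =>
    rw [← (measurePreserving_piFinSuccAbove μ 0).symm.map_eq,
      ← (measurePreserving_piFinSuccAbove ν 0).symm.map_eq]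
    exact ((h 0).prod (ih fun i => h _)).map (MeasurableEquiv.measurable _)

/-- A measurable set meeting every line in direction `v` at most once is null for every s-finite
measure that is invariant under translations along `v`. -/
theorem measure_eq_zero_of_forall_line {E : Type*} [AddCommGroup E] [Module ℝ E]
    [MeasurableSpace E] [MeasurableAdd E] (μ : Measure E) [SFinite μ] {v : E} {s : Set E}
    (hs : MeasurableSet s) (hμ : ∀ t : ℝ, μ.map (· + t • v) = μ)
    (hline : ∀ x ∈ s, ∀ t : ℝ, x + t • v ∈ s → t = 0) : μ s = 0 := by
  by_contra hne
  have hmeas (t : ℝ) : MeasurableSet ((· + t • v) ⁻¹' s) := measurable_add_const _ hs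
  have hcount := Measure.countable_meas_pos_of_disjoint_iUnion (μ := μ) hmeas (by
    intro t u htu
    refine Set.disjoint_left.2 fun x hx hx' => htu ?_
    have := hline _ hx (u - t) (by
      rw [add_assoc, ← add_smul, add_sub_cancel]
      exact hx')
    linarith)
  refine Set.not_countable_univ (α := ℝ) (hcount.mono fun t _ => ?_)
  rw [Set.mem_ofPred_eq, ← Measure.map_apply (measurable_add_const _) hs, hμ t]
  exact pos_iff_ne_zero.2 hne

/-- An underdetermined homogeneous system has a nonzero solution supported on a prescribed set of
coordinates, as soon as this set has more elements than there are equations. -/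
theorem exists_ne_zero_supported_mulVec_eq_zero {k n : ℕ} (A : Fin k → Fin n → ℝ)
    (T : Finset (Fin n)) (hT : k < T.card) :
    ∃ v : Fin n → ℝ, v ≠ 0 ∧ (∀ i ∉ T, v i = 0) ∧ ∀ i, ∑ j, A i j * v j = 0 := by
  let f : (Fin n → ℝ) →ₗ[ℝ] (Fin k → ℝ) × ({i // i ∉ T} → ℝ) :=
    (Matrix.mulVecLin (Matrix.of A)).prod (LinearMap.funLeft ℝ ℝ Subtype.val)
  have hcard : Fintype.card {i // i ∉ T} + T.card = n := by
    rw [Fintype.card_subtype_compl, Fintype.card_fin, Fintype.card_coe]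
    have := T.card_le_univ
    rw [Fintype.card_fin] at this
    omega
  have hker : LinearMap.ker f ≠ ⊥ := LinearMap.ker_ne_bot_of_finrank_lt (by
    rw [Module.finrank_prod]
    simp only [Module.finrank_fintype_fun_eq_card, Fintype.card_fin]
    omega)
  obtain ⟨v, hv, hv0⟩ := (Submodule.ne_bot_iff _).1 hker
  have hv' := Prod.ext_iff.1 (LinearMap.mem_ker.1 hv)
  exact ⟨v, hv0, fun i hi => congrFun hv'.2 ⟨i, hi⟩, fun i => congrFun hv'.1 i⟩

/-- The set on which a linear encoder with `k` measurements is inverted by a measurable decoder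
carries no mass on vectors with a given set `T`, `k < #T`, of coordinates outside `S`. -/
theorem measure_decodable_inter_box_eq_zero {k n : ℕ} (A : Fin k → Fin n → ℝ)
    {g : (Fin k → ℝ) → Fin n → ℝ} (hg : Measurable g) (μ : Measure ℝ) [IsProbabilityMeasure μ]
    {S : Set ℝ} (hμ : μ.restrict Sᶜ ≪ volume)
    (T : Finset (Fin n)) (hT : k < T.card) :
    (Measure.pi fun _ : Fin n => μ)
      ({x | g (fun i => ∑ j, A i j * x j) = x} ∩ {x | ∀ i, i ∈ T ↔ x i ∉ S}) = 0 := by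
  obtain ⟨v, hv0, hvT, hAv⟩ := exists_ne_zero_supported_mulVec_eq_zero A T hT
  set D : Set (Fin n → ℝ) := {x | g (fun i => ∑ j, A i j * x j) = x}
  have hD : MeasurableSet D := measurableSet_eq_fun (by fun_prop) measurable_id
  let B : Fin n → Set ℝ := fun i => if i ∈ T then Sᶜ else S
  have hB : {x : Fin n → ℝ | ∀ i, i ∈ T ↔ x i ∉ S} = Set.univ.pi B := by
    ext x
    simp only [Set.mem_ofPred_eq, Set.mem_pi, Set.mem_univ, true_imp_iff, B]
    refine forall_congr' fun i => ?_
    by_cases hi : i ∈ T <;> simp [hi]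
  let ν : Fin n → Measure ℝ := fun i => if i ∈ T then volume else μ
  have hν (i : Fin n) : SigmaFinite (ν i) := by
    by_cases hi : i ∈ T
    · simp only [ν, if_pos hi]
      infer_instance
    · simp only [ν, if_neg hi]
      infer_instance
  have hac : (Measure.pi fun i => μ.restrict (B i)) ≪ Measure.pi ν := by
    refine pi_absolutelyContinuous fun i => ?_
    by_cases hi : i ∈ T
    · simpa only [ν, B, if_pos hi] using hμ
    · simpa only [ν, B, if_neg hi] using Measure.restrict_le_self.absolutelyContinuous
  have hinv (t : ℝ) : (Measure.pi ν).map (· + t • v) = Measure.pi ν := by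
    refine (measurePreserving_pi ν ν (f := fun i x => x + t * v i) fun i => ?_).map_eq
    by_cases hi : i ∈ T
    · simp only [ν, if_pos hi]
      exact measurePreserving_add_right volume _
    · simp only [hvT i hi, mul_zero, add_zero]
      exact MeasurePreserving.id _
  rw [hB, ← Measure.restrict_apply hD, Measure.restrict_pi_pi]
  refine hac (measure_eq_zero_of_forall_line (v := v) _ hD hinv fun x hx t hxt => ?_)
  have hA : (fun i => ∑ j, A i j * (x + t • v) j) = fun i => ∑ j, A i j * x j := by
    funext i
    have : ∑ j, A i j * (x + t • v) j = ∑ j, A i j * x j + t * ∑ j, A i j * v j := by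
      rw [Finset.mul_sum, ← Finset.sum_add_distrib]
      refine Finset.sum_congr rfl fun j _ => ?_
      simp only [Pi.add_apply, Pi.smul_apply, smul_eq_mul]
      ring
    rw [this, hAv, mul_zero, add_zero]
  have hxt' : g (fun i => ∑ j, A i j * (x + t • v) j) = x + t • v := hxt
  rw [hA, show g (fun i => ∑ j, A i j * x j) = x from hx, left_eq_add] at hxt'
  exact (smul_eq_zero.1 hxt').resolve_right hv0

/-- The number of i.i.d. samples falling in a measurable set, of probability `p`, concentrates
around `n * p`. -/
theorem measure_sum_indicator_le {n : ℕ} (hn : 0 < n) (μ : Measure ℝ) [IsProbabilityMeasure μ]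
    {U : Set ℝ} (hU : MeasurableSet U) {r : ℝ} (hr : r < μ.real U) :
    (Measure.pi fun _ : Fin n => μ) {x | ∑ i, U.indicator 1 (x i) ≤ r * n} ≤
      ENNReal.ofReal (ProbabilityTheory.variance (U.indicator 1) μ / (μ.real U - r) ^ 2 / n) := by
  have hn' : (0 : ℝ) < n := Nat.cast_pos.2 hn
  have hmem : MemLp (U.indicator (1 : ℝ → ℝ)) 2 μ := (memLp_const (1 : ℝ)).indicator hU
  let N : (Fin n → ℝ) → ℝ := ∑ i, fun x => U.indicator 1 (x i)
  have hmemi (i : Fin n) : MemLp (fun x : Fin n → ℝ => U.indicator (1 : ℝ → ℝ) (x i)) 2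
      (Measure.pi fun _ => μ) :=
    hmem.comp_measurePreserving (measurePreserving_eval (fun _ : Fin n => μ) i)
  have hN : MemLp N 2 (Measure.pi fun _ : Fin n => μ) := memLp_finsetSum' _ fun i _ => hmemi i
  have hNapp (x : Fin n → ℝ) : N x = ∑ i, U.indicator 1 (x i) := Finset.sum_apply _ _ _
  have hmean : ∫ x, N x ∂(Measure.pi fun _ : Fin n => μ) = n * μ.real U := by
    simp only [hNapp]
    rw [integral_finsetSum _ fun i _ => (hmemi i).integrable (by norm_num)]
    have (i : Fin n) : ∫ x, U.indicator (1 : ℝ → ℝ) (x i) ∂(Measure.pi fun _ : Fin n => μ) =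
        μ.real U := by
      rw [integral_comp_eval (μ := fun _ : Fin n => μ) hmem.aestronglyMeasurable,
        integral_indicator_one hU]
    simp [this]
  have hvar : ProbabilityTheory.variance N (Measure.pi fun _ : Fin n => μ) = n * ProbabilityTheory.variance (U.indicator 1) μ := by
    rw [ProbabilityTheory.variance_sum_pi (μ := fun _ : Fin n => μ) fun _ => hmem]
    simp
  have hpos : 0 < n * (μ.real U - r) := mul_pos hn' (sub_pos.2 hr)
  refine (measure_mono fun x hx => ?_).trans
    ((ProbabilityTheory.meas_ge_le_variance_div_sq hN hpos).trans_eq ?_)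
  · rw [Set.mem_ofPred_eq, ← hNapp] at hx
    rw [Set.mem_ofPred_eq, hmean, abs_sub_comm]
    exact le_trans (by linarith) (le_abs_self _)
  · rw [hvar]
    congr 1
    have := (sub_pos.2 hr).ne'
    field_simp

/-- Converse for linear encoding of discrete-continuous mixtures: if
`P_X = (1−γ)P_d + γP_c` with `0 < γ ≤ 1` and `0 < R < γ`, then there is no sequence of
matrices `A_n ∈ ℝ^{⌊Rn⌋×n}` and Borel decoders `g_n` with
`P(g_n(A_n Xⁿ) = Xⁿ) ≥ 1 − ε` for all sufficiently large `n`. -/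
theorem stmt4 (Pd Pc : Measure ℝ) [IsProbabilityMeasure Pd] [IsProbabilityMeasure Pc]
    -- `Pd` is purely atomic: it is carried by a countable set
    (S : Set ℝ) (hS : S.Countable) (hSd : Pd Sᶜ = 0)
    -- `Pc` is absolutely continuous w.r.t. Lebesgue measure
    (hPc : Pc ≪ (volume : Measure ℝ))
    (γ : ℝ) (hγ0 : 0 < γ) (hγ1 : γ ≤ 1)
    -- the mixture `P_X = (1−γ)P_d + γP_c`
    (PX : Measure ℝ) [IsProbabilityMeasure PX]
    (hPX : PX = ENNReal.ofReal (1 - γ) • Pd + ENNReal.ofReal γ • Pc)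
    (ε : ℝ) (hε0 : 0 < ε) (hε1 : ε < 1)
    (R : ℝ) (hR0 : 0 < R) (hRγ : R < γ) :
    ¬ ∃ (A : ∀ n : ℕ, Fin (⌊R * (n : ℝ)⌋₊) → Fin n → ℝ)
        (g : ∀ n : ℕ, (Fin (⌊R * (n : ℝ)⌋₊) → ℝ) → (Fin n → ℝ)),
        (∀ n, Measurable (g n)) ∧
        (∀ᶠ n in Filter.atTop,
          ENNReal.ofReal (1 - ε) ≤
            (Measure.pi fun _ : Fin n => PX)
              {x | g n (fun i => ∑ j, A n i j * x j) = x}) := by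
  rintro ⟨A, g, hg, hdec⟩
  have hSm : MeasurableSet S := hS.measurableSet
  have hres : PX.restrict Sᶜ ≪ volume := by
    have : Pd.restrict Sᶜ = 0 := Measure.restrict_eq_zero.2 hSd
    rw [hPX, Measure.restrict_add, Measure.restrict_smul, Measure.restrict_smul, this, smul_zero,
      zero_add]
    exact (Measure.smul_absolutelyContinuous).trans
      (Measure.restrict_le_self.absolutelyContinuous.trans hPc)
  have hmass : PX.real Sᶜ = γ := by
    have hPcS : Pc Sᶜ = 1 := (prob_compl_eq_one_iff hSm).2 (hPc (hS.measure_zero _))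
    rw [measureReal_def, hPX]
    simp [hSd, hPcS, hγ0.le]
  have hbound : ∀ᶠ n : ℕ in atTop, ENNReal.ofReal (1 - ε) ≤
      ENNReal.ofReal (ProbabilityTheory.variance (Sᶜ.indicator 1) PX / (PX.real Sᶜ - R) ^ 2 / n) := by
    filter_upwards [hdec, eventually_gt_atTop 0] with n hn hn0
    refine hn.trans (le_trans ?_ (measure_sum_indicator_le hn0 PX hSm.compl (by rwa [hmass])))
    have hnull := (measure_biUnion_null_iff (Set.to_countable _)).2
      fun T (hT : T ∈ {T : Finset (Fin n) | ⌊R * (n : ℝ)⌋₊ < T.card}) =>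
        measure_decodable_inter_box_eq_zero (A n) (hg n) PX hres T hT
    refine measure_mono_ae (measure_mono_null (fun x hx => ?_) hnull)
    classical
    obtain ⟨hxD, hxN⟩ := Classical.not_imp.1 hx
    let T : Finset (Fin n) := {i | x i ∉ S}
    have hcard : ∑ i, Sᶜ.indicator (1 : ℝ → ℝ) (x i) = T.card := by
      rw [← Finset.sum_boole]
      simp [Set.indicator_apply]
    refine Set.mem_biUnion (x := T) ?_ ⟨hxD, fun i => by simp [T]⟩
    refine (Nat.floor_lt (by positivity)).2 (not_le.1 fun h => hxN ?_)
    exact hcard.trans_le h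
  have hlim := (ENNReal.continuous_ofReal.tendsto 0).comp
    (tendsto_const_div_atTop_nhds_zero_nat (ProbabilityTheory.variance (Sᶜ.indicator 1) PX / (PX.real Sᶜ - R) ^ 2))
  have := ge_of_tendsto hlim hbound
  rw [ENNReal.ofReal_zero, nonpos_iff_eq_zero, ENNReal.ofReal_eq_zero] at this
  linarith
end

section
/- Let k ≥ m ≥ 1 be integers, let B be a k×m random matrix with i.i.d. Gaussian N(0,1/k) entries, and let σ_min(B) = min{‖Bx‖ : x ∈ ℝ^m, ‖x‖ = 1} be its least singular value. Then for every t > 0, P(σ_min(B) ≤ t) ≤ (2 k^{(k−m+1)/2} E_{k,m} / (k − m + 1)) · t^{k−m+1}, where E_{k,m} = √π · 2^{−(k−m+1)/2} · Γ((k+1)/2) / ( Γ(m/2) · Γ((k−m+1)/2) · Γ((k−m+2)/2) ). -/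
open MeasureTheory ProbabilityTheory Filter Real
open scoped NNReal ENNReal Topology

/-- Least singular value of a `k×m` matrix: `σ_min(B) = min{‖Bx‖ : ‖x‖ = 1}`
(Euclidean norms), expressed as an infimum. -/
noncomputable def sigmaMin (k m : ℕ) (B : Fin k → Fin m → ℝ) : ℝ :=
  sInf {r : ℝ | ∃ x : Fin m → ℝ, (∑ j, (x j) ^ 2) = 1 ∧
    r = Real.sqrt (∑ i, (∑ j, B i j * x j) ^ 2)}

/-- The Edelman constant
`E_{k,m} = √π 2^{−(k−m+1)/2} Γ((k+1)/2) / (Γ(m/2) Γ((k−m+1)/2) Γ((k−m+2)/2))`. -/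
noncomputable def Ekm (k m : ℕ) : ℝ :=
  Real.sqrt Real.pi * (2 : ℝ) ^ (-(((k : ℝ) - m + 1) / 2)) * Real.Gamma (((k : ℝ) + 1) / 2) /
    (Real.Gamma ((m : ℝ) / 2) * Real.Gamma (((k : ℝ) - m + 1) / 2) *
      Real.Gamma (((k : ℝ) - m + 2) / 2))

/-- The law of a vector with i.i.d. centered Gaussian coordinates of variance `v`. -/
noncomputable abbrev gaussianPi (ι : Type*) [Fintype ι] (v : ℝ≥0) : Measure (ι → ℝ) :=
  Measure.pi fun _ : ι => gaussianReal 0 v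

lemma charFun_gaussianPi {ι : Type*} [Fintype ι] (v : ℝ≥0) (t : EuclideanSpace ℝ ι) :
    charFun ((gaussianPi ι v).map (WithLp.toLp 2)) t = Complex.exp (-(v * ‖t‖ ^ 2 / 2)) := by
  rw [charFun_pi]
  simp_rw [charFun_gaussianReal, ← Complex.exp_sum, ← Complex.ofReal_pow,
    EuclideanSpace.real_norm_sq_eq]
  simp [Finset.sum_div, Finset.mul_sum]

lemma map_mulVec_gaussianPi {ι κ : Type*} [Fintype ι] [Fintype κ] [DecidableEq κ]
    (v : ℝ≥0) (Q : Matrix κ ι ℝ) (hQ : Q * Q.transpose = 1) :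
    (gaussianPi ι v).map Q.mulVec = gaussianPi κ v := by
  have hm : Measurable Q.mulVec :=
    (Continuous.matrix_mulVec continuous_const continuous_id).measurable
  have key : ((gaussianPi ι v).map Q.mulVec).map (WithLp.toLp 2)
      = (gaussianPi κ v).map (WithLp.toLp 2) := by
    apply Measure.ext_of_charFun (E := EuclideanSpace ℝ κ)
    ext t
    have h1 : charFun (((gaussianPi ι v).map Q.mulVec).map (WithLp.toLp 2)) t
        = charFun ((gaussianPi ι v).map (WithLp.toLp 2))
          (WithLp.toLp 2 (Q.transpose.mulVec t)) := by
      rw [charFun_apply, charFun_apply, integral_map (by fun_prop) (by fun_prop),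
        integral_map (by fun_prop) (by fun_prop), integral_map (by fun_prop) (by fun_prop)]
      congr 1
      ext x
      congr 3
      simp only [EuclideanSpace.inner_eq_star_dotProduct, star_trivial]
      rw [Matrix.dotProduct_mulVec, Matrix.mulVec_transpose]
    have h2 : ‖(WithLp.toLp 2 (Q.transpose.mulVec t) : EuclideanSpace ℝ ι)‖ ^ 2 = ‖t‖ ^ 2 := by
      rw [← real_inner_self_eq_norm_sq, ← real_inner_self_eq_norm_sq]
      simp only [EuclideanSpace.inner_eq_star_dotProduct, star_trivial]
      rw [Matrix.dotProduct_mulVec, Matrix.vecMul_transpose, Matrix.mulVec_mulVec, hQ,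
        Matrix.one_mulVec]
    rw [h1, charFun_gaussianPi, charFun_gaussianPi]
    congr 4
    exact_mod_cast h2
  have h3 := congrArg (Measure.map (WithLp.ofLp)) key
  have h4 (μ : Measure (κ → ℝ)) :
      (μ.map (WithLp.toLp 2)).map (WithLp.ofLp : WithLp 2 (κ → ℝ) → κ → ℝ) = μ := by
    rw [Measure.map_map (by fun_prop) (by fun_prop)]
    exact Measure.map_id
  rwa [h4, h4] at h3

lemma lintegral_fin_prod_eq_prod {n : ℕ} {α : Type*} [MeasurableSpace α] (μ : Measure α)
    [SigmaFinite μ] (f : Fin n → α → ℝ≥0∞) (hf : ∀ i, Measurable (f i)) :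
    ∫⁻ x, ∏ i, f i (x i) ∂(Measure.pi fun _ : Fin n => μ) = ∏ i, ∫⁻ x, f i x ∂μ := by
  induction n with
  | zero => simp
  | succ n ih =>
    rw [← ((measurePreserving_piFinSuccAbove (fun _ : Fin (n + 1) => μ) 0).symm).lintegral_comp_emb
      (MeasurableEquiv.measurableEmbedding _)]
    simp_rw [MeasurableEquiv.piFinSuccAbove_symm_apply, Fin.insertNthEquiv,
      Fin.prod_univ_succ, Equiv.coe_fn_mk, Fin.insertNth_zero]
    change ∫⁻ a : α × (Fin n → α), f 0 a.1 * ∏ i : Fin n, f i.succ (a.2 i)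
      ∂(μ.prod (Measure.pi fun _ => μ)) = _
    rw [lintegral_prod_mul (f := f 0) (g := fun x : Fin n → α => ∏ i : Fin n, f i.succ (x i))
      (hf 0).aemeasurable
      (Finset.measurable_prod _ fun i _ => (hf _).comp (measurable_pi_apply i)).aemeasurable,
      ← ih _ fun i => hf _]

lemma gaussianPi_apply {n : ℕ} {v : ℝ≥0} (hv : v ≠ 0) {s : Set (Fin n → ℝ)}
    (hs : MeasurableSet s) :
    gaussianPi (Fin n) v s = ∫⁻ x in s, ENNReal.ofReal
      ((2 * π * v) ^ (-((n : ℝ) / 2)) * rexp (-(∑ i, x i ^ 2) / (2 * v))) := by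
  have hdens : ∀ x : Fin n → ℝ, ENNReal.ofReal
      ((2 * π * v) ^ (-((n : ℝ) / 2)) * rexp (-(∑ i, x i ^ 2) / (2 * v)))
      = ∏ i, gaussianPDF 0 v (x i) := by
    intro x
    simp only [gaussianPDF, gaussianPDFReal, sub_zero]
    rw [← ENNReal.ofReal_prod_of_nonneg (fun i _ => by positivity), Finset.prod_mul_distrib,
      ← Real.exp_sum, Finset.prod_const, Finset.card_univ, Fintype.card_fin]
    congr 2
    · rw [Real.sqrt_eq_rpow, ← Real.rpow_neg (by positivity), ← Real.rpow_natCast,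
        ← Real.rpow_mul (by positivity)]
      congr 1; ring
    · rw [← Finset.sum_div, Finset.sum_neg_distrib]
  simp_rw [hdens]
  rw [← withDensity_apply _ hs]
  congr 1
  refine Measure.pi_eq fun t ht => ?_
  rw [withDensity_apply _ (MeasurableSet.univ_pi ht)]
  have h1 : ∀ x : Fin n → ℝ, (Set.univ.pi t).indicator (fun x => ∏ i, gaussianPDF 0 v (x i)) x
      = ∏ i, (t i).indicator (gaussianPDF 0 v) (x i) := by
    intro x
    by_cases hx : x ∈ Set.univ.pi t
    · rw [Set.indicator_of_mem hx]
      exact Finset.prod_congr rfl fun i _ => (Set.indicator_of_mem (hx i trivial) _).symm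
    · rw [Set.indicator_of_notMem hx]
      simp only [Set.mem_pi, not_forall] at hx
      obtain ⟨i, _, hi⟩ := hx
      exact (Finset.prod_eq_zero (Finset.mem_univ i) (Set.indicator_of_notMem hi _)).symm
  rw [← lintegral_indicator (MeasurableSet.univ_pi ht)]
  simp_rw [h1]
  rw [volume_pi, lintegral_fin_prod_eq_prod volume (fun i => (t i).indicator (gaussianPDF 0 v))
    fun i => (measurable_gaussianPDF 0 v).indicator (ht i)]
  refine Finset.prod_congr rfl fun i _ => ?_
  rw [lintegral_indicator (ht i), gaussianReal_apply 0 hv]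

lemma measurePreserving_swap_pi_pi {ι κ α : Type*} [Fintype ι] [Fintype κ] [MeasurableSpace α]
    (μ : Measure α) [IsProbabilityMeasure μ] :
    MeasurePreserving (fun (B : ι → κ → α) j i => B i j)
      (Measure.pi fun _ : ι => Measure.pi fun _ : κ => μ)
      (Measure.pi fun _ : κ => Measure.pi fun _ : ι => μ) := by
  have hm : Measurable (fun (B : ι → κ → α) j i => B i j) := by fun_prop
  refine ⟨hm, ?_⟩
  apply (MeasurableEquiv.curry κ ι α).symm.map_measurableEquiv_injective
  have h1 := Measure.infinitePi_map_curry_symm (fun (_ : κ) (_ : ι) => μ)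
  have h2 := Measure.infinitePi_map_curry_symm (fun (_ : ι) (_ : κ) => μ)
  simp only [Measure.infinitePi_eq_pi] at h1 h2
  have h3 := (measurePreserving_piCongrLeft (fun _ : κ × ι => μ) (Equiv.prodComm ι κ)).map_eq
  rw [h1, ← h3, ← h2, Measure.map_map (by fun_prop) hm]
  rw [Measure.map_map (by fun_prop) (by fun_prop)]
  rfl

/-- The Gram matrix of the rows of `Y`. -/
def rowGram {m k : ℕ} (Y : Fin m → Fin k → ℝ) : Matrix (Fin m) (Fin m) ℝ :=
  Matrix.of Y * (Matrix.of Y).transpose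

lemma exists_orthonormalBasis_sum_orthogonal {j d k : ℕ} (hk : k = j + d)
    (X : Fin j → EuclideanSpace ℝ (Fin k)) :
    ∃ b : OrthonormalBasis (Fin j ⊕ Fin d) ℝ (EuclideanSpace ℝ (Fin k)),
      ∀ i l, inner ℝ (X i) (b (Sum.inr l)) = 0 := by
  set S := Submodule.span ℝ (Set.range X)
  have h1 : Module.finrank ℝ S ≤ j :=
    (finrank_range_le_card (R := ℝ) X).trans (Fintype.card_fin j).le
  have h2 := S.finrank_add_finrank_orthogonal
  rw [finrank_euclideanSpace, Fintype.card_fin] at h2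
  have h3 : d ≤ Module.finrank ℝ Sᗮ := by omega
  let e := stdOrthonormalBasis ℝ Sᗮ
  let v : Fin j ⊕ Fin d → EuclideanSpace ℝ (Fin k) :=
    Sum.elim (fun _ => 0) fun l => (e (Fin.castLE h3 l) : EuclideanSpace ℝ (Fin k))
  have hv : Orthonormal ℝ ((Set.range Sum.inr).domRestrict v) := by
    have h4 : Orthonormal ℝ fun l : Fin d => (e (Fin.castLE h3 l) : EuclideanSpace ℝ (Fin k)) :=
      (e.orthonormal.comp_linearIsometry Sᗮ.subtypeₗᵢ).comp _ (Fin.castLE_injective h3)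
    constructor
    · rintro ⟨_, l, rfl⟩
      exact h4.1 l
    · rintro ⟨_, l, rfl⟩ ⟨_, l', rfl⟩ hne
      exact h4.2 fun h => hne (by rw [h])
  obtain ⟨b, hb⟩ := hv.exists_orthonormalBasis_extension_of_card_eq (by simp [hk])
  refine ⟨b, fun i l => ?_⟩
  rw [hb _ ⟨l, rfl⟩]
  exact (e (Fin.castLE h3 l)).2 _ (Submodule.subset_span ⟨i, rfl⟩)

lemma exists_orthogonal_matrix_sum {j d k : ℕ} (hk : k = j + d) (X : Fin j → Fin k → ℝ) :
    ∃ Q : Matrix (Fin j ⊕ Fin d) (Fin k) ℝ, Q * Q.transpose = 1 ∧ Q.transpose * Q = 1 ∧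
      ∀ i l, X i ⬝ᵥ Q (Sum.inr l) = 0 := by
  obtain ⟨b, hb⟩ := exists_orthonormalBasis_sum_orthogonal hk fun i => WithLp.toLp 2 (X i)
  have h1 : (Matrix.of fun s => b s) * (Matrix.of fun s => (b s : Fin k → ℝ)).transpose = 1 := by
    ext s s'
    have := orthonormal_iff_ite.1 b.orthonormal s' s
    rw [EuclideanSpace.inner_eq_star_dotProduct] at this
    rw [Matrix.one_apply, Matrix.mul_apply']
    exact this.symm ▸ (by simp [eq_comm])
  refine ⟨Matrix.of fun s => b s, h1,
    (Matrix.mul_eq_one_comm_of_card_eq _ _ _ (by simp [hk])).1 h1, fun i l => ?_⟩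
  have := hb i l
  rw [EuclideanSpace.inner_eq_star_dotProduct, dotProduct_comm] at this
  exact this

lemma rowGram_apply {m k : ℕ} (Y : Fin m → Fin k → ℝ) (i i' : Fin m) :
    rowGram Y i i' = Y i ⬝ᵥ Y i' := rfl

lemma rowGram_mulVec {m k : ℕ} (Y : Fin m → Fin k → ℝ) (q : Fin m → ℝ) (i : Fin m) :
    (rowGram Y).mulVec q i = Y i ⬝ᵥ (Matrix.vecMul q (Matrix.of Y)) := by
  rw [rowGram, ← Matrix.mulVec_mulVec, Matrix.mulVec_transpose]
  rfl

lemma mulVec_dotProduct_mulVec_of_transpose_mul_self {ι κ : Type*} [Fintype ι] [Fintype κ]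
    [DecidableEq ι] {Q : Matrix κ ι ℝ} (hQ : Q.transpose * Q = 1) (x y : ι → ℝ) :
    Q.mulVec x ⬝ᵥ Q.mulVec y = x ⬝ᵥ y := by
  rw [Matrix.dotProduct_mulVec, ← Matrix.mulVec_transpose, Matrix.mulVec_mulVec, hQ,
    Matrix.one_mulVec]

lemma exists_rowGram_cons_mulVec {j d k : ℕ} (hk : k = j + d) (X : Fin j → Fin k → ℝ) :
    ∃ (Q : Matrix (Fin j ⊕ Fin d) (Fin k) ℝ) (T : Matrix (Fin j) (Fin j) ℝ),
      Q * Q.transpose = 1 ∧ T.det ^ 2 = (rowGram X).det ∧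
      ∀ (a : Fin k → ℝ) (c : Fin j → ℝ), (∀ i, T.mulVec c i = Q.mulVec a (Sum.inl i)) →
        (rowGram (Fin.cons a X)).mulVec (Fin.cons 1 (-c))
          = Pi.single 0 (∑ l, Q.mulVec a (Sum.inr l) ^ 2) := by
  obtain ⟨Q, hQ, hQ', hX⟩ := exists_orthogonal_matrix_sum hk X
  have hX' : ∀ i l, Q.mulVec (X i) (Sum.inr l) = 0 := fun i l => by
    rw [Matrix.mulVec, dotProduct_comm]; exact hX i l
  let T : Matrix (Fin j) (Fin j) ℝ := Matrix.of fun i i' => Q.mulVec (X i') (Sum.inl i)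
  have hT : T.transpose * T = rowGram X := by
    ext i i'
    rw [rowGram_apply, ← mulVec_dotProduct_mulVec_of_transpose_mul_self hQ' (X i) (X i')]
    simp [dotProduct, hX', Matrix.mul_apply, T]
  refine ⟨Q, T, hQ, by rw [← hT, Matrix.det_mul, Matrix.det_transpose, sq], fun a c hc => ?_⟩
  set ρ := Matrix.vecMul (Fin.cons 1 (-c) : Fin (j + 1) → ℝ)
    (Matrix.of (Fin.cons a X : Fin (j + 1) → Fin k → ℝ)) with hρ
  have hρa : ρ = a - ∑ i, c i • X i := by
    ext l
    simp [hρ, Matrix.vecMul, dotProduct, Fin.sum_univ_succ, sub_eq_add_neg]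
  have hQρ : Q.mulVec ρ = Q.mulVec a - ∑ i, c i • Q.mulVec (X i) := by
    rw [hρa, Matrix.mulVec_sub, Matrix.mulVec_sum]
    simp_rw [Matrix.mulVec_smul]
  have hl : ∀ i, Q.mulVec ρ (Sum.inl i) = 0 := fun i => by
    rw [hQρ, Pi.sub_apply, ← hc i]
    simp [T, Matrix.mulVec, dotProduct, mul_comm]
  have hr : ∀ l, Q.mulVec ρ (Sum.inr l) = Q.mulVec a (Sum.inr l) := fun l => by
    rw [hQρ]
    simp [hX']
  ext i
  rw [rowGram_mulVec, ← hρ, ← mulVec_dotProduct_mulVec_of_transpose_mul_self hQ']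
  refine Fin.cases ?_ (fun i => ?_) i
  · simp [dotProduct, hl, hr, sq]
  · simp [dotProduct, hl, hX']

lemma det_rowGram_cons {j k : ℕ} {X : Fin j → Fin k → ℝ} {a : Fin k → ℝ} {c : Fin j → ℝ} {s : ℝ}
    (h : (rowGram (Fin.cons a X)).mulVec (Fin.cons 1 (-c)) = Pi.single 0 s) :
    (rowGram (Fin.cons a X)).det = (rowGram X).det * s := by
  set G := rowGram (Fin.cons a X : Fin (j + 1) → Fin k → ℝ) with hG
  have h1 := congrFun (congrArg (G.cramer) h) 0
  rw [Matrix.cramer_eq_adjugate_mulVec, Matrix.mulVec_mulVec, Matrix.adjugate_mul] at h1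
  simp only [Matrix.smul_mulVec, Matrix.one_mulVec, Pi.smul_apply, Fin.cons_zero, smul_eq_mul,
    mul_one] at h1
  rw [h1, Matrix.cramer_apply, Matrix.det_succ_column_zero, Fin.sum_univ_succ]
  have h2 : (G.updateCol 0 (Pi.single 0 s)).submatrix Fin.succ Fin.succ = rowGram X := by
    ext i i'
    simp [hG, rowGram_apply]
  simp [h2, mul_comm]

lemma prod_gaussianPi_mulVec {j d k : ℕ} (v : ℝ≥0) {Q : Matrix (Fin j ⊕ Fin d) (Fin k) ℝ}
    (hQ : Q * Q.transpose = 1) :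
    MeasurePreserving
      (fun a => ((fun i => Q.mulVec a (Sum.inl i), fun l => Q.mulVec a (Sum.inr l)) :
        (Fin j → ℝ) × (Fin d → ℝ)))
      (gaussianPi (Fin k) v) ((gaussianPi (Fin j) v).prod (gaussianPi (Fin d) v)) := by
  have h1 : MeasurePreserving Q.mulVec (gaussianPi (Fin k) v) (gaussianPi (Fin j ⊕ Fin d) v) :=
    ⟨(Continuous.matrix_mulVec continuous_const continuous_id).measurable,
      map_mulVec_gaussianPi v Q hQ⟩
  exact (measurePreserving_sumPiEquivProdPi fun _ : Fin j ⊕ Fin d => gaussianReal 0 v).comp h1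

lemma volume_sum_sq_le (n : ℕ) {r : ℝ} (hr : 0 ≤ r) :
    volume {x : Fin n → ℝ | ∑ i, x i ^ 2 ≤ r ^ 2}
      = ENNReal.ofReal (√π ^ n / Gamma ((n : ℝ) / 2 + 1) * r ^ n) := by
  rcases n with _ | n
  · simp [sq_nonneg, volume_pi]
  have h1 := EuclideanSpace.volume_closedBall (Fin (n + 1)) (0 : EuclideanSpace ℝ (Fin (n + 1))) r
  rw [← (PiLp.volume_preserving_toLp (Fin (n + 1))).measure_preimage
    Metric.isClosed_closedBall.measurableSet.nullMeasurableSet] at h1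
  have h2 : WithLp.toLp 2 ⁻¹' Metric.closedBall (0 : EuclideanSpace ℝ (Fin (n + 1))) r
      = {x : Fin (n + 1) → ℝ | ∑ i, x i ^ 2 ≤ r ^ 2} := by
    ext x
    rw [Set.mem_preimage, mem_closedBall_zero_iff, EuclideanSpace.norm_eq,
      Real.sqrt_le_left hr]
    simp
  rw [← h2, h1, ← ENNReal.ofReal_pow hr, ← ENNReal.ofReal_mul (by positivity), mul_comm]
  simp

lemma gaussianPi_le_volume {n : ℕ} {v : ℝ≥0} (hv : v ≠ 0) {s : Set (Fin n → ℝ)}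
    (hs : MeasurableSet s) :
    gaussianPi (Fin n) v s ≤ ENNReal.ofReal ((2 * π * v) ^ (-((n : ℝ) / 2))) * volume s := by
  rw [gaussianPi_apply hv hs, ← setLIntegral_const]
  refine lintegral_mono fun x => ENNReal.ofReal_le_ofReal ?_
  have h1 : rexp (-(∑ i, x i ^ 2) / (2 * v)) ≤ 1 := by
    rw [Real.exp_le_one_iff]
    exact div_nonpos_of_nonpos_of_nonneg
      (neg_nonpos.2 (Finset.sum_nonneg fun i _ => sq_nonneg _)) (by positivity)
  exact mul_le_of_le_one_right (by positivity) h1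

/-- The vector `w = G⁻¹ z`, for `G` the Gram matrix of `Y`, makes an angle of tangent at most `δ`
with `z`, and `|z|² ≤ r² ⟪z, w⟫`. -/
def IsNearInverse {m k : ℕ} (δ r : ℝ) (Y : Fin m → Fin k → ℝ) (z : Fin m → ℝ) : Prop :=
  (rowGram Y).det ≠ 0 ∧
    ((rowGram Y)⁻¹.mulVec z ⬝ᵥ (rowGram Y)⁻¹.mulVec z) * (z ⬝ᵥ z)
      ≤ (1 + δ ^ 2) * (z ⬝ᵥ (rowGram Y)⁻¹.mulVec z) ^ 2 ∧
    z ⬝ᵥ z ≤ r ^ 2 * (z ⬝ᵥ (rowGram Y)⁻¹.mulVec z)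

lemma IsNearInverse.sum_sq_le {j k : ℕ} {δ r s : ℝ} {X : Fin j → Fin k → ℝ} {a : Fin k → ℝ}
    {c : Fin j → ℝ} (hs : 0 ≤ s)
    (h : (rowGram (Fin.cons a X)).mulVec (Fin.cons 1 (-c)) = Pi.single 0 s)
    (hY : IsNearInverse δ r (Fin.cons a X) (Pi.single 0 1)) :
    ∑ i, c i ^ 2 ≤ δ ^ 2 ∧ s ≤ r ^ 2 := by
  obtain ⟨h0, h1, h2⟩ := hY
  have hs0 : s ≠ 0 := by
    rintro rfl
    exact h0 (by rw [det_rowGram_cons h, mul_zero])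
  have hs' : 0 < s := lt_of_le_of_ne hs hs0.symm
  have hw : (rowGram (Fin.cons a X))⁻¹.mulVec (Pi.single 0 1 : Fin (j + 1) → ℝ)
      = s⁻¹ • (Fin.cons 1 (-c) : Fin (j + 1) → ℝ) := by
    have h3 : (Pi.single 0 1 : Fin (j + 1) → ℝ) = s⁻¹ • Pi.single 0 s := by
      rw [← Pi.single_smul, smul_eq_mul, inv_mul_cancel₀ hs0]
    rw [h3, ← h, Matrix.mulVec_smul, Matrix.mulVec_mulVec,
      Matrix.nonsing_inv_mul _ (isUnit_iff_ne_zero.2 h0), Matrix.one_mulVec]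
  rw [hw] at h1 h2
  simp only [dotProduct, Fin.sum_univ_succ, Pi.single_apply, Pi.smul_apply, Fin.cons_zero,
    Fin.cons_succ, Pi.neg_apply, smul_eq_mul, Fin.succ_ne_zero, if_true, if_false, mul_one,
    zero_mul, Finset.sum_const_zero, add_zero, one_mul] at h1 h2
  have h4 : ∑ i, s⁻¹ * -c i * (s⁻¹ * -c i) = s⁻¹ ^ 2 * ∑ i, c i ^ 2 := by
    rw [Finset.mul_sum]; exact Finset.sum_congr rfl fun i _ => by ring
  rw [h4] at h1
  refine ⟨?_, ?_⟩
  · have h5 : 0 < s⁻¹ ^ 2 := by positivity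
    nlinarith
  · rwa [← div_eq_mul_inv, le_div_iff₀ hs', one_mul] at h2

lemma gaussianPi_isNearInverse_cons_le {j d k : ℕ} (hk : k = j + d) {v : ℝ≥0} (hv : v ≠ 0)
    {δ r : ℝ} (hδ : 0 ≤ δ) (hr : 0 ≤ r) {X : Fin j → Fin k → ℝ} (hX : (rowGram X).det ≠ 0) :
    gaussianPi (Fin k) v {a | IsNearInverse δ r (Fin.cons a X) (Pi.single 0 1)}
      ≤ ENNReal.ofReal ((2 * π * v) ^ (-((k : ℝ) / 2)) * (√π ^ j / Gamma ((j : ℝ) / 2 + 1) * δ ^ j)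
          * (√π ^ d / Gamma ((d : ℝ) / 2 + 1) * r ^ d)) * ENNReal.ofReal √(rowGram X).det := by
  obtain ⟨Q, T, hQ, hT, h⟩ := exists_rowGram_cons_mulVec hk X
  have hT0 : T.det ≠ 0 := by
    rintro h0
    rw [h0] at hT
    exact hX (by rw [← hT]; ring)
  set A : Set (Fin j → ℝ) := Matrix.toLin' T '' {c | ∑ i, c i ^ 2 ≤ δ ^ 2} with hA
  set B : Set (Fin d → ℝ) := {u | ∑ l, u l ^ 2 ≤ r ^ 2} with hB
  have hAm : MeasurableSet A := by
    have h1 : A = (Matrix.toLin' T⁻¹) ⁻¹' {c | ∑ i, c i ^ 2 ≤ δ ^ 2} := by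
      refine congrFun (Set.image_eq_preimage_of_inverse (fun x => ?_) (fun x => ?_)) _
      · simp [Matrix.mulVec_mulVec, Matrix.nonsing_inv_mul _ (isUnit_iff_ne_zero.2 hT0)]
      · simp [Matrix.mulVec_mulVec, Matrix.mul_nonsing_inv _ (isUnit_iff_ne_zero.2 hT0)]
    rw [h1]
    exact (LinearMap.continuous_of_finiteDimensional _).measurable
      (measurableSet_le (by fun_prop) measurable_const)
  have hBm : MeasurableSet B := measurableSet_le (by fun_prop) measurable_const
  have hsub : {a | IsNearInverse δ r (Fin.cons a X) (Pi.single 0 1)} ⊆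
      (fun a => ((fun i => Q.mulVec a (Sum.inl i), fun l => Q.mulVec a (Sum.inr l)) :
        (Fin j → ℝ) × (Fin d → ℝ))) ⁻¹' (A ×ˢ B) := by
    intro a ha
    set c := T⁻¹.mulVec fun i => Q.mulVec a (Sum.inl i) with hc
    have hTc : T.mulVec c = fun i => Q.mulVec a (Sum.inl i) := by
      rw [hc, Matrix.mulVec_mulVec, Matrix.mul_nonsing_inv _ (isUnit_iff_ne_zero.2 hT0),
        Matrix.one_mulVec]
    have h1 := IsNearInverse.sum_sq_le (Finset.sum_nonneg fun l _ => sq_nonneg _)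
      (h a c (congrFun hTc)) ha
    exact ⟨⟨c, h1.1, hTc⟩, h1.2⟩
  refine (measure_mono hsub).trans ?_
  rw [(prod_gaussianPi_mulVec v hQ).measure_preimage (hAm.prod hBm).nullMeasurableSet,
    Measure.prod_prod]
  refine (mul_le_mul' (gaussianPi_le_volume hv hAm) (gaussianPi_le_volume hv hBm)).trans ?_
  rw [hA, Measure.addHaar_image_linearMap, hB, volume_sum_sq_le _ hδ, volume_sum_sq_le _ hr,
    ← hT, Real.sqrt_sq_eq_abs, LinearMap.det_toLin']
  have hv' : (0 : ℝ) < v := by positivity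
  have hg1 : 0 ≤ Gamma ((j : ℝ) / 2 + 1) := (Gamma_pos_of_pos (by positivity)).le
  have hg2 : 0 ≤ Gamma ((d : ℝ) / 2 + 1) := (Gamma_pos_of_pos (by positivity)).le
  have hj : 0 ≤ √π ^ j / Gamma ((j : ℝ) / 2 + 1) * δ ^ j := by positivity
  have hd : 0 ≤ √π ^ d / Gamma ((d : ℝ) / 2 + 1) * r ^ d := by positivity
  simp only [← ENNReal.ofReal_mul' hj, ← ENNReal.ofReal_mul' hd,
    ← ENNReal.ofReal_mul' (abs_nonneg T.det)]
  rw [← ENNReal.ofReal_mul (by positivity), ← ENNReal.ofReal_mul (by positivity)]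
  apply ENNReal.ofReal_le_ofReal
  have h5 : (2 * π * v) ^ (-((k : ℝ) / 2))
      = (2 * π * v : ℝ) ^ (-((j : ℝ) / 2)) * (2 * π * v : ℝ) ^ (-((d : ℝ) / 2)) := by
    rw [← Real.rpow_add (by positivity), hk]
    congr 1; push_cast; ring
  rw [h5]
  exact le_of_eq (by ring)

lemma gaussianPi_eq_withDensity (n : ℕ) {v : ℝ≥0} (hv : v ≠ 0) :
    gaussianPi (Fin n) v = volume.withDensity fun x => ENNReal.ofReal
      ((2 * π * v) ^ (-((n : ℝ) / 2)) * rexp (-(∑ i, x i ^ 2) / (2 * v))) := by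
  ext s hs
  rw [gaussianPi_apply hv hs, withDensity_apply _ hs]

lemma lintegral_norm_gaussianPi {d : ℕ} (hd : d ≠ 0) {v : ℝ≥0} (hv : v ≠ 0) :
    ∫⁻ w, ENNReal.ofReal √(∑ l, w l ^ 2) ∂(gaussianPi (Fin d) v)
      = ENNReal.ofReal (√(2 * v) * Gamma (((d : ℝ) + 1) / 2) / Gamma ((d : ℝ) / 2)) := by
  have hv' : (0 : ℝ) < v := by positivity
  have : NeZero d := ⟨hd⟩
  have hd' : (0 : ℝ) < d := by positivity
  set C : ℝ := (2 * π * v) ^ (-((d : ℝ) / 2)) with hC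
  have hC0 : 0 ≤ C := by positivity
  set f : ℝ → ℝ := fun y => C * rexp (-(1 / (2 * v)) * y ^ 2) * y with hf
  rw [gaussianPi_eq_withDensity d hv, lintegral_withDensity_eq_lintegral_mul _ (by fun_prop)
    (by fun_prop)]
  have h1 : ∀ w : EuclideanSpace ℝ (Fin d), ((fun x : Fin d → ℝ => ENNReal.ofReal
      (C * rexp (-(∑ i, x i ^ 2) / (2 * v)))) *
        fun w : Fin d → ℝ => ENNReal.ofReal √(∑ l, w l ^ 2)) w.ofLp
      = ENNReal.ofReal (f ‖w‖) := by
    intro w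
    rw [Pi.mul_apply, ← ENNReal.ofReal_mul (by positivity), ← EuclideanSpace.real_norm_sq_eq,
      Real.sqrt_sq (norm_nonneg _)]
    simp only [hf]
    congr 4
    ring
  rw [← (PiLp.volume_preserving_ofLp (Fin d)).lintegral_comp (by fun_prop), lintegral_congr h1]
  have h2 : ∀ y ∈ Set.Ioi (0 : ℝ), y ^ (Module.finrank ℝ (EuclideanSpace ℝ (Fin d)) - 1) • f y
      = C * (y ^ (d : ℝ) * rexp (-(1 / (2 * v)) * y ^ (2 : ℝ))) := by
    intro y hy
    obtain ⟨e, rfl⟩ := Nat.exists_eq_succ_of_ne_zero hd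
    simp only [finrank_euclideanSpace, Fintype.card_fin, hf, smul_eq_mul, Real.rpow_natCast,
      Real.rpow_two, Nat.succ_eq_add_one, Nat.add_sub_cancel]
    ring
  have hint : Integrable (fun w : EuclideanSpace ℝ (Fin d) => f ‖w‖) := by
    rw [integrable_fun_norm_addHaar, integrableOn_congr_fun h2 measurableSet_Ioi]
    refine Integrable.const_mul ?_ _
    simp only [Real.rpow_two]
    exact (integrable_rpow_mul_exp_neg_mul_sq (by positivity) (by linarith)).integrableOn
  rw [← ofReal_integral_eq_lintegral_ofReal hint
    (Filter.Eventually.of_forall fun w => by simp only [hf]; positivity),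
    integral_fun_norm_addHaar, setIntegral_congr_fun measurableSet_Ioi h2,
    integral_const_mul, integral_rpow_mul_exp_neg_mul_rpow two_pos (by linarith) (by positivity)]
  congr 1
  have h3 : volume.real (Metric.ball (0 : EuclideanSpace ℝ (Fin d)) 1)
      = √π ^ d / Gamma ((d : ℝ) / 2 + 1) := by
    rw [Measure.real, EuclideanSpace.volume_ball]
    simp [Gamma_nonneg_of_nonneg (show 0 ≤ (d : ℝ) / 2 + 1 by positivity), div_nonneg]
  have h4 : (1 / (2 * v : ℝ)) ^ (-((d : ℝ) + 1) / 2) = (2 * v) ^ ((d : ℝ) / 2) * √(2 * v) := by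
    rw [one_div, Real.inv_rpow (by positivity), ← Real.rpow_neg (by positivity), Real.sqrt_eq_rpow,
      ← Real.rpow_add (by positivity)]
    congr 1; ring
  have h5 : C * (√π ^ d * (2 * v) ^ ((d : ℝ) / 2)) = 1 := by
    rw [← Real.rpow_natCast, Real.sqrt_eq_rpow, ← Real.rpow_mul (by positivity),
      show 1 / 2 * (d : ℝ) = d / 2 by ring, ← Real.mul_rpow (by positivity) (by positivity),
      show π * (2 * v) = 2 * π * v by ring, hC, ← Real.rpow_add (by positivity)]
    simp
  have hg : Gamma ((d : ℝ) / 2) ≠ 0 := (Gamma_pos_of_pos (by positivity)).ne'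
  rw [h3, h4, Gamma_add_one (by positivity)]
  simp only [finrank_euclideanSpace, Fintype.card_fin, smul_eq_mul, nsmul_eq_mul]
  calc _ = (C * (√π ^ d * (2 * v) ^ ((d : ℝ) / 2))) *
        (√(2 * v) * Gamma (((d : ℝ) + 1) / 2) / Gamma ((d : ℝ) / 2)) := by field_simp
    _ = _ := by rw [h5, one_mul]

lemma le_gaussianPi_cone {j : ℕ} {v : ℝ≥0} (hv : v ≠ 0) {δ : ℝ} (hδ : 0 ≤ δ) :
    ENNReal.ofReal ((2 * π * v) ^ (-(((j : ℝ) + 1) / 2)) *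
        (√π ^ j / Gamma ((j : ℝ) / 2 + 1) * δ ^ j) * (2 * v / (1 + δ ^ 2)) ^ (((j : ℝ) + 1) / 2) *
        Gamma (((j : ℝ) + 1) / 2))
      ≤ gaussianPi (Fin (j + 1)) v {z | ∑ i : Fin j, z i.succ ^ 2 ≤ δ ^ 2 * z 0 ^ 2} := by
  have hv' : (0 : ℝ) < v := by positivity
  have hg : 0 ≤ Gamma ((j : ℝ) / 2 + 1) := (Gamma_pos_of_pos (by positivity)).le
  set c : ℝ := √π ^ j / Gamma ((j : ℝ) / 2 + 1) * δ ^ j with hc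
  have hc0 : 0 ≤ c := by positivity
  set b : ℝ := (1 + δ ^ 2) / (2 * v) with hb
  have hb0 : 0 < b := by positivity
  set C : ℝ := (2 * π * v) ^ (-(((j : ℝ) + 1) / 2)) with hC
  have hmeas : MeasurableSet {p : ℝ × (Fin j → ℝ) | ∑ i, p.2 i ^ 2 ≤ δ ^ 2 * p.1 ^ 2} :=
    measurableSet_le (by fun_prop) (by fun_prop)
  have h1 : gaussianPi (Fin (j + 1)) v {z | ∑ i : Fin j, z i.succ ^ 2 ≤ δ ^ 2 * z 0 ^ 2}
      = ∫⁻ s, gaussianPi (Fin j) v {y | ∑ i, y i ^ 2 ≤ δ ^ 2 * s ^ 2} ∂(gaussianReal 0 v) := by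
    have h2 := (measurePreserving_piFinSuccAbove
      (fun _ : Fin (j + 1) => gaussianReal 0 v) 0).measure_preimage hmeas.nullMeasurableSet
    rw [Measure.prod_apply hmeas] at h2
    exact h2
  have h2 : ∀ s : ℝ, ENNReal.ofReal ((2 * π * v) ^ (-((j : ℝ) / 2)) *
      rexp (-(δ ^ 2 * s ^ 2) / (2 * v)) * (c * |s| ^ j))
      ≤ gaussianPi (Fin j) v {y | ∑ i, y i ^ 2 ≤ δ ^ 2 * s ^ 2} := by
    intro s
    have h3 : δ ^ 2 * s ^ 2 = (δ * |s|) ^ 2 := by rw [mul_pow, sq_abs]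
    have h4 := volume_sum_sq_le j (r := δ * |s|) (by positivity)
    rw [mul_pow δ |s| j, ← mul_assoc, ← hc] at h4
    have hms : MeasurableSet {y : Fin j → ℝ | ∑ i, y i ^ 2 ≤ (δ * |s|) ^ 2} :=
      measurableSet_le (by fun_prop) measurable_const
    rw [h3, gaussianPi_apply hv hms, ENNReal.ofReal_mul (by positivity), ← h4,
      ← setLIntegral_const]
    refine setLIntegral_mono' hms fun y hy => ENNReal.ofReal_le_ofReal ?_
    have hy' : ∑ i, y i ^ 2 ≤ (δ * |s|) ^ 2 := hy
    gcongr
  have hφ : Measurable fun s : ℝ => gaussianPi (Fin j) v {y | ∑ i, y i ^ 2 ≤ δ ^ 2 * s ^ 2} :=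
    measurable_measure_prodMk_left hmeas
  have hint : Integrable fun s : ℝ => C * c * (|s| ^ (j : ℝ) * rexp (-b * |s| ^ (2 : ℝ))) := by
    refine Integrable.const_mul ?_ _
    refine (integrable_rpow_mul_exp_neg_mul_sq hb0 (s := j)
      (by linarith [j.cast_nonneg (α := ℝ)])).norm.congr (Filter.Eventually.of_forall fun s => ?_)
    simp
  have h3 : ∫ s : ℝ, C * c * (|s| ^ (j : ℝ) * rexp (-b * |s| ^ (2 : ℝ)))
      = C * c * (2 * v / (1 + δ ^ 2)) ^ (((j : ℝ) + 1) / 2) * Gamma (((j : ℝ) + 1) / 2) := by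
    rw [integral_const_mul, integral_comp_abs (f := fun y => y ^ (j : ℝ) * rexp (-b * y ^ (2 : ℝ))),
      integral_rpow_mul_exp_neg_mul_rpow two_pos (by linarith [j.cast_nonneg (α := ℝ)]) hb0,
      neg_div, Real.rpow_neg hb0.le, ← Real.inv_rpow hb0.le, hb, inv_div]
    ring
  rw [h1, gaussianReal_of_var_ne_zero 0 hv, lintegral_withDensity_eq_lintegral_mul _
    (measurable_gaussianPDF 0 v) hφ, ← h3,
    ofReal_integral_eq_lintegral_ofReal hint (Filter.Eventually.of_forall fun s => by positivity)]
  refine lintegral_mono fun s => ?_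
  refine le_trans (le_of_eq ?_) (mul_le_mul_right (h2 s) _)
  rw [gaussianPDF, ← ENNReal.ofReal_mul (gaussianPDFReal_nonneg _ _ _), gaussianPDFReal]
  congr 1
  have h5 : C = (√(2 * π * v))⁻¹ * (2 * π * v) ^ (-((j : ℝ) / 2)) := by
    rw [hC, Real.sqrt_eq_rpow, ← Real.rpow_neg (by positivity), ← Real.rpow_add (by positivity)]
    congr 1; ring
  have h6 : rexp (-b * |s| ^ (2 : ℝ))
      = rexp (-(s - 0) ^ 2 / (2 * v)) * rexp (-(δ ^ 2 * s ^ 2) / (2 * v)) := by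
    rw [← Real.exp_add, Real.rpow_two, sq_abs, hb]
    congr 1; field_simp; ring
  rw [h5, h6, Real.rpow_natCast]
  ring

lemma continuous_rowGram {m k : ℕ} : Continuous (rowGram : (Fin m → Fin k → ℝ) → _) :=
  Continuous.matrix_mul (A := fun Y : Fin m → Fin k → ℝ => Matrix.of Y) continuous_id
    (Continuous.matrix_transpose continuous_id)

lemma measurable_det_rowGram {m k : ℕ} :
    Measurable fun Y : Fin m → Fin k → ℝ => (rowGram Y).det :=
  continuous_rowGram.matrix_det.measurable

lemma measurePreserving_finCons {n : ℕ} {α : Type*} [MeasurableSpace α] (μ : Measure α)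
    [SigmaFinite μ] :
    MeasurePreserving (fun p : α × (Fin n → α) => (Fin.cons p.1 p.2 : Fin (n + 1) → α))
      (μ.prod (Measure.pi fun _ => μ)) (Measure.pi fun _ => μ) := by
  have h := (measurePreserving_piFinSuccAbove (fun _ : Fin (n + 1) => μ) 0).symm
  convert h using 1
  ext p
  simp

lemma lintegral_pi_fin_succ {n : ℕ} {α : Type*} [MeasurableSpace α] (μ : Measure α)
    [SigmaFinite μ] {F : (Fin (n + 1) → α) → ℝ≥0∞} (hF : Measurable F) :
    ∫⁻ Y, F Y ∂(Measure.pi fun _ => μ)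
      = ∫⁻ X, ∫⁻ a, F (Fin.cons a X) ∂μ ∂(Measure.pi fun _ : Fin n => μ) := by
  have hpre := measurePreserving_finCons (n := n) μ
  rw [← hpre.lintegral_comp hF]
  exact lintegral_prod_symm' _ (hF.comp hpre.measurable)

lemma exists_det_rowGram_cons_eq {j d k : ℕ} (hk : k = j + d) {X : Fin j → Fin k → ℝ}
    (hX : (rowGram X).det ≠ 0) :
    ∃ Q : Matrix (Fin j ⊕ Fin d) (Fin k) ℝ, Q * Q.transpose = 1 ∧
      ∀ a, (rowGram (Fin.cons a X)).det
        = (rowGram X).det * ∑ l, Q.mulVec a (Sum.inr l) ^ 2 := by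
  obtain ⟨Q, T, hQ, hT, h⟩ := exists_rowGram_cons_mulVec hk X
  refine ⟨Q, hQ, fun a => det_rowGram_cons (c := T⁻¹.mulVec fun i => Q.mulVec a (Sum.inl i))
    (h _ _ fun i => ?_)⟩
  have hT0 : T.det ≠ 0 := by
    rintro h0
    rw [h0] at hT
    exact hX (by rw [← hT]; ring)
  rw [Matrix.mulVec_mulVec, Matrix.mul_nonsing_inv _ (isUnit_iff_ne_zero.2 hT0), Matrix.one_mulVec]

lemma measurePreserving_mulVec_inr {j d k : ℕ} (v : ℝ≥0) {Q : Matrix (Fin j ⊕ Fin d) (Fin k) ℝ}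
    (hQ : Q * Q.transpose = 1) :
    MeasurePreserving (fun a l => Q.mulVec a (Sum.inr l))
      (gaussianPi (Fin k) v) (gaussianPi (Fin d) v) :=
  measurePreserving_snd.comp (prod_gaussianPi_mulVec v hQ)

lemma det_rowGram_nonneg {m k : ℕ} (Y : Fin m → Fin k → ℝ) : 0 ≤ (rowGram Y).det := by
  have := (Matrix.posSemidef_self_mul_conjTranspose (Matrix.of Y)).det_nonneg
  rwa [Matrix.conjTranspose_eq_transpose_of_trivial] at this

lemma ae_det_rowGram_ne_zero {m k : ℕ} (hmk : m ≤ k) {v : ℝ≥0} (hv : v ≠ 0) :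
    ∀ᵐ Y ∂(Measure.pi fun _ : Fin m => gaussianPi (Fin k) v), (rowGram Y).det ≠ 0 := by
  induction m with
  | zero => simp
  | succ j ih =>
    have hs : MeasurableSet {Y : Fin (j + 1) → Fin k → ℝ | (rowGram Y).det = 0} :=
      measurableSet_eq_fun measurable_det_rowGram measurable_const
    have hpre := measurePreserving_finCons (n := j) (gaussianPi (Fin k) v)
    rw [ae_iff]
    simp only [not_not]
    rw [← hpre.measure_preimage hs.nullMeasurableSet, Measure.prod_apply_symm (hpre.measurable hs)]
    rw [lintegral_eq_zero_iff (measurable_measure_prodMk_right (hpre.measurable hs))]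
    filter_upwards [ih (by omega)] with X hX
    obtain ⟨Q, hQ, h⟩ := exists_det_rowGram_cons_eq (d := k - j) (by omega) hX
    have h0 : gaussianPi (Fin (k - j)) v {0} = 0 := by
      rw [gaussianPi_eq_withDensity _ hv]
      refine withDensity_absolutelyContinuous _ _ ?_
      have : Nonempty (Fin (k - j)) := ⟨⟨0, by omega⟩⟩
      exact measure_singleton 0
    rw [← (measurePreserving_mulVec_inr v hQ).measure_preimage
      (measurableSet_singleton 0).nullMeasurableSet] at h0
    rw [Pi.zero_apply, ← h0]
    congr 1
    ext a
    simp only [Set.mem_preimage, Set.mem_ofPred_eq, h, mul_eq_zero, hX, false_or,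
      Set.mem_singleton_iff]
    rw [Finset.sum_eq_zero_iff_of_nonneg fun _ _ => sq_nonneg _]
    simp [funext_iff]

lemma lintegral_sqrt_det_rowGram {j k : ℕ} (hjk : j ≤ k) {v : ℝ≥0} (hv : v ≠ 0) :
    ∫⁻ Y, ENNReal.ofReal √(rowGram Y).det ∂(Measure.pi fun _ : Fin j => gaussianPi (Fin k) v)
      = ENNReal.ofReal ((2 * v) ^ ((j : ℝ) / 2) * Gamma (((k : ℝ) + 1) / 2)
          / Gamma (((k : ℝ) - j + 1) / 2)) := by
  induction j with
  | zero =>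
    have : Gamma (((k : ℝ) + 1) / 2) ≠ 0 := (Gamma_pos_of_pos (by positivity)).ne'
    simp [this]
  | succ j ih =>
    have hmeas : ∀ n, Measurable fun Y : Fin n → Fin k → ℝ => ENNReal.ofReal √(rowGram Y).det :=
      fun n => (measurable_det_rowGram.sqrt).ennreal_ofReal
    rw [lintegral_pi_fin_succ _ (hmeas _)]
    obtain ⟨d, rfl⟩ : ∃ d, k = j + d := ⟨k - j, by omega⟩
    have hd : d ≠ 0 := by omega
    have h1 : ∀ᵐ X ∂(Measure.pi fun _ : Fin j => gaussianPi (Fin (j + d)) v),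
        ∫⁻ a, ENNReal.ofReal √(rowGram (Fin.cons a X : Fin (j + 1) → _)).det
          ∂(gaussianPi (Fin (j + d)) v)
        = ENNReal.ofReal √(rowGram X).det * ENNReal.ofReal
          (√(2 * v) * Gamma (((d : ℝ) + 1) / 2) / Gamma ((d : ℝ) / 2)) := by
      filter_upwards [ae_det_rowGram_ne_zero (by omega) hv] with X hX
      obtain ⟨Q, hQ, h⟩ := exists_det_rowGram_cons_eq rfl hX
      simp_rw [h, Real.sqrt_mul (det_rowGram_nonneg X), ENNReal.ofReal_mul (Real.sqrt_nonneg _)]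
      rw [lintegral_const_mul' _ _ ENNReal.ofReal_ne_top, ← lintegral_norm_gaussianPi hd hv,
        ← (measurePreserving_mulVec_inr v hQ).lintegral_comp (by fun_prop)]
    rw [lintegral_congr_ae h1, lintegral_mul_const _ (hmeas _), ih (by omega)]
    have hg1 : 0 < Gamma (((d : ℝ) + 1) / 2) := Gamma_pos_of_pos (by positivity)
    have hg2 : 0 < Gamma (((j : ℝ) + d + 1) / 2) := Gamma_pos_of_pos (by positivity)
    have e1 : ((j : ℝ) + d - j + 1) / 2 = (d + 1) / 2 := by ring
    have e2 : ((j : ℝ) + d - (j + 1) + 1) / 2 = d / 2 := by ring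
    have e3 : ((2 : ℝ) * v) ^ (((j : ℝ) + 1) / 2) = (2 * v) ^ ((j : ℝ) / 2) * √(2 * v) := by
      rw [Real.sqrt_eq_rpow, ← Real.rpow_add (by positivity)]
      congr 1; ring
    push_cast
    rw [e1, e2, e3, ← ENNReal.ofReal_mul (by positivity)]
    congr 1
    field_simp

lemma exists_orthogonal_matrix_mulVec_eq_single {j : ℕ} {x : Fin (j + 1) → ℝ} (hx : x ⬝ᵥ x = 1) :
    ∃ R : Matrix (Fin (j + 1)) (Fin (j + 1)) ℝ, R * R.transpose = 1 ∧
      R.mulVec x = Pi.single 0 1 := by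
  have hv : Orthonormal ℝ (({0} : Set (Fin (j + 1))).domRestrict
      fun _ => (WithLp.toLp 2 x : EuclideanSpace ℝ (Fin (j + 1)))) := by
    constructor
    · rintro ⟨_, rfl⟩
      rw [Set.domRestrict_apply, ← sq_eq_sq₀ (norm_nonneg _) zero_le_one,
        ← real_inner_self_eq_norm_sq, EuclideanSpace.inner_eq_star_dotProduct]
      simpa using hx
    · rintro ⟨_, rfl⟩ ⟨_, rfl⟩ hne
      exact absurd rfl hne
  obtain ⟨b, hb⟩ := hv.exists_orthonormalBasis_extension_of_card_eq (by simp)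
  have h0 : b 0 = WithLp.toLp 2 x := hb 0 rfl
  have h1 : ∀ s s', (b s : Fin (j + 1) → ℝ) ⬝ᵥ b s' = if s = s' then 1 else 0 := fun s s' => by
    have := orthonormal_iff_ite.1 b.orthonormal s' s
    rw [EuclideanSpace.inner_eq_star_dotProduct] at this
    simpa [eq_comm] using this
  refine ⟨Matrix.of fun s => b s, ?_, ?_⟩
  · ext s s'
    rw [Matrix.one_apply, ← h1]
    rfl
  · ext s
    have := h1 s 0
    rw [h0] at this
    rw [Pi.single_apply, ← this]
    rfl

lemma gaussianPi_cone_eq {j : ℕ} {v : ℝ≥0} {δ : ℝ} {x : Fin (j + 1) → ℝ} (hx : x ⬝ᵥ x = 1) :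
    gaussianPi (Fin (j + 1)) v {z | z ⬝ᵥ z ≤ (1 + δ ^ 2) * (z ⬝ᵥ x) ^ 2}
      = gaussianPi (Fin (j + 1)) v {z | ∑ i : Fin j, z i.succ ^ 2 ≤ δ ^ 2 * z 0 ^ 2} := by
  obtain ⟨R, hR, hRx⟩ := exists_orthogonal_matrix_mulVec_eq_single hx
  have hm : Measurable R.mulVec :=
    (Continuous.matrix_mulVec continuous_const continuous_id).measurable
  conv_rhs => rw [← map_mulVec_gaussianPi v R hR]
  rw [Measure.map_apply hm (measurableSet_le (by fun_prop) (by fun_prop))]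
  congr 1
  ext z
  have h := mulVec_dotProduct_mulVec_of_transpose_mul_self (mul_eq_one_comm.1 hR)
  have h0 : z ⬝ᵥ x = R.mulVec z 0 := by
    rw [← h z x, hRx]
    simp
  have h1 : z ⬝ᵥ z = R.mulVec z 0 ^ 2 + ∑ i : Fin j, R.mulVec z i.succ ^ 2 := by
    rw [← h z z, dotProduct, Fin.sum_univ_succ]
    simp_rw [← sq]
  simp only [Set.mem_ofPred_eq, Set.mem_preimage, h0, h1]
  constructor <;> intro h <;> linarith

lemma rowGram_mul {m k : ℕ} (R : Matrix (Fin m) (Fin m) ℝ) (Y : Fin m → Fin k → ℝ) :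
    rowGram (Matrix.of.symm (R * Matrix.of Y)) = R * rowGram Y * R.transpose := by
  change R * Matrix.of Y * (R * Matrix.of Y).transpose =
    R * (Matrix.of Y * (Matrix.of Y).transpose) * _
  rw [Matrix.transpose_mul]
  simp only [Matrix.mul_assoc]

lemma isNearInverse_mul {m k : ℕ} {δ r : ℝ} {R : Matrix (Fin m) (Fin m) ℝ}
    (hR : R * R.transpose = 1) (Y : Fin m → Fin k → ℝ) (z : Fin m → ℝ) :
    IsNearInverse δ r (Matrix.of.symm (R * Matrix.of Y)) (R.mulVec z) ↔ IsNearInverse δ r Y z := by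
  have hR' := mul_eq_one_comm.1 hR
  have hinv : R⁻¹ = R.transpose := Matrix.inv_eq_right_inv hR
  have hinv' : R.transpose⁻¹ = R := Matrix.inv_eq_right_inv hR'
  have hdet : (rowGram (Matrix.of.symm (R * Matrix.of Y))).det = (rowGram Y).det := by
    rw [rowGram_mul, Matrix.det_mul, Matrix.det_mul, mul_right_comm, ← Matrix.det_mul, hR,
      Matrix.det_one, one_mul]
  have hw : (rowGram (Matrix.of.symm (R * Matrix.of Y)))⁻¹.mulVec (R.mulVec z)
      = R.mulVec ((rowGram Y)⁻¹.mulVec z) := by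
    rw [rowGram_mul, Matrix.mul_inv_rev, Matrix.mul_inv_rev, hinv, hinv', Matrix.mulVec_mulVec,
      Matrix.mulVec_mulVec, Matrix.mul_assoc, Matrix.mul_assoc, hR', Matrix.mul_one]
  rw [IsNearInverse, IsNearInverse, hdet, hw]
  simp only [mulVec_dotProduct_mulVec_of_transpose_mul_self hR']

lemma isNearInverse_smul {m k : ℕ} {δ r c : ℝ} (hc : c ≠ 0) (Y : Fin m → Fin k → ℝ)
    (z : Fin m → ℝ) : IsNearInverse δ r Y (c • z) ↔ IsNearInverse δ r Y z := by
  simp only [IsNearInverse, Matrix.mulVec_smul, smul_dotProduct, dotProduct_smul, smul_eq_mul]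
  have h2 : 0 < c ^ 2 := by positivity
  have h4 : 0 < c ^ 4 := by positivity
  refine and_congr_right fun _ => and_congr ?_ ?_
  · conv_rhs => rw [← mul_le_mul_iff_right₀ h4]
    ring_nf
  · conv_rhs => rw [← mul_le_mul_iff_right₀ h2]
    ring_nf

lemma measurePreserving_mul_left_gaussianPi {m k : ℕ} (v : ℝ≥0) {R : Matrix (Fin m) (Fin m) ℝ}
    (hR : R * R.transpose = 1) :
    MeasurePreserving (fun Y : Fin m → Fin k → ℝ => (Matrix.of.symm (R * Matrix.of Y)))
      (Measure.pi fun _ : Fin m => gaussianPi (Fin k) v)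
      (Measure.pi fun _ : Fin m => gaussianPi (Fin k) v) := by
  have hm : Measurable R.mulVec :=
    (Continuous.matrix_mulVec continuous_const continuous_id).measurable
  have h1 : MeasurePreserving (fun (B : Fin k → Fin m → ℝ) l => R.mulVec (B l))
      (Measure.pi fun _ : Fin k => gaussianPi (Fin m) v)
      (Measure.pi fun _ : Fin k => gaussianPi (Fin m) v) :=
    measurePreserving_pi _ _ fun _ => ⟨hm, map_mulVec_gaussianPi v R hR⟩
  exact ((measurePreserving_swap_pi_pi (gaussianReal 0 v)).comp h1).comp
    (measurePreserving_swap_pi_pi (gaussianReal 0 v))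

lemma isNearInverse_of_isMin {m k : ℕ} {δ r t q : ℝ} {Y : Fin m → Fin k → ℝ} {x z : Fin m → ℝ}
    (hdet : (rowGram Y).det ≠ 0)
    (hxq : Matrix.vecMul x (Matrix.of Y) ⬝ᵥ Matrix.vecMul x (Matrix.of Y) = q)
    (hmin : ∀ w, q * (w ⬝ᵥ w) ≤ Matrix.vecMul w (Matrix.of Y) ⬝ᵥ Matrix.vecMul w (Matrix.of Y))
    (hq : q ≤ t ^ 2) (hr : r ^ 2 = (1 + δ ^ 2) * t ^ 2)
    (hz : z ⬝ᵥ z ≤ (1 + δ ^ 2) * (z ⬝ᵥ x) ^ 2) : IsNearInverse δ r Y z := by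
  set w := (rowGram Y)⁻¹.mulVec z with hw
  have hGw : z = (rowGram Y).mulVec w := by
    rw [hw, Matrix.mulVec_mulVec, Matrix.mul_nonsing_inv _ (isUnit_iff_ne_zero.2 hdet),
      Matrix.one_mulVec]
  have hzu : ∀ u, z ⬝ᵥ u = Matrix.vecMul w (Matrix.of Y) ⬝ᵥ Matrix.vecMul u (Matrix.of Y) := by
    intro u
    rw [hGw, rowGram, ← Matrix.mulVec_mulVec, Matrix.mulVec_transpose, dotProduct_comm,
      Matrix.dotProduct_mulVec, dotProduct_comm]
  have hCS : (z ⬝ᵥ x) ^ 2 ≤ (z ⬝ᵥ w) * q := by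
    rw [hzu x, hzu w, ← hxq]
    simp only [dotProduct, ← sq]
    exact Finset.sum_mul_sq_le_sq_mul_sq _ _ _
  have hzw : 0 ≤ z ⬝ᵥ w := by
    rw [hzu w]
    exact Finset.sum_nonneg fun _ _ => mul_self_nonneg _
  have hww : 0 ≤ w ⬝ᵥ w := Finset.sum_nonneg fun _ _ => mul_self_nonneg _
  have h1 : z ⬝ᵥ z ≤ (1 + δ ^ 2) * ((z ⬝ᵥ w) * q) :=
    hz.trans (mul_le_mul_of_nonneg_left hCS (by positivity))
  have hδ : (0 : ℝ) ≤ 1 + δ ^ 2 := by positivity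
  refine ⟨hdet, ?_, ?_⟩
  · calc (w ⬝ᵥ w) * (z ⬝ᵥ z) ≤ (w ⬝ᵥ w) * ((1 + δ ^ 2) * ((z ⬝ᵥ w) * q)) :=
          mul_le_mul_of_nonneg_left h1 hww
      _ = (1 + δ ^ 2) * ((z ⬝ᵥ w) * (q * (w ⬝ᵥ w))) := by ring
      _ ≤ (1 + δ ^ 2) * ((z ⬝ᵥ w) * (z ⬝ᵥ w)) :=
          mul_le_mul_of_nonneg_left (mul_le_mul_of_nonneg_left ((hmin w).trans (hzu w).ge) hzw) hδ
      _ = _ := by ring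
  · calc z ⬝ᵥ z ≤ (1 + δ ^ 2) * ((z ⬝ᵥ w) * q) := h1
      _ ≤ (1 + δ ^ 2) * ((z ⬝ᵥ w) * t ^ 2) :=
          mul_le_mul_of_nonneg_left (mul_le_mul_of_nonneg_left hq hzw) hδ
      _ = _ := by rw [hr]; ring

lemma exists_sigmaMin_eq {k j : ℕ} (B : Fin k → Fin (j + 1) → ℝ) :
    ∃ x : Fin (j + 1) → ℝ, x ⬝ᵥ x = 1 ∧
      (∑ i, (∑ l, B i l * x l) ^ 2) = sigmaMin k (j + 1) B ^ 2 ∧ 0 ≤ sigmaMin k (j + 1) B ∧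
      ∀ w : Fin (j + 1) → ℝ,
        sigmaMin k (j + 1) B ^ 2 * (w ⬝ᵥ w) ≤ ∑ i, (∑ l, B i l * w l) ^ 2 := by
  set S : Set (Fin (j + 1) → ℝ) := {x | ∑ l, x l ^ 2 = 1} with hS
  have hcpt : IsCompact S := by
    refine Metric.isCompact_of_isClosed_isBounded
      (isClosed_eq (by fun_prop) continuous_const) ?_
    refine (Metric.isBounded_closedBall (x := (0 : Fin (j + 1) → ℝ)) (r := 1)).subset fun x hx => ?_
    rw [mem_closedBall_zero_iff, pi_norm_le_iff_of_nonneg zero_le_one]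
    intro l
    have h1 : x l ^ 2 ≤ 1 := by
      rw [← show ∑ l, x l ^ 2 = 1 from hx]
      exact Finset.single_le_sum (f := fun l => x l ^ 2) (fun _ _ => sq_nonneg _)
        (Finset.mem_univ l)
    rwa [Real.norm_eq_abs, ← sq_le_one_iff_abs_le_one]
  have hne : S.Nonempty := ⟨Pi.single 0 1, by
    rw [hS, Set.mem_ofPred_eq, Fin.sum_univ_succ]; simp⟩
  obtain ⟨x, hx, hmin⟩ := hcpt.exists_isMinOn hne
    (f := fun x => √(∑ i, (∑ l, B i l * x l) ^ 2)) (by fun_prop)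
  have hσ : sigmaMin k (j + 1) B = √(∑ i, (∑ l, B i l * x l) ^ 2) := by
    refine IsLeast.csInf_eq ⟨⟨x, hx, rfl⟩, ?_⟩
    rintro _ ⟨y, hy, rfl⟩
    exact hmin hy
  have hsq : sigmaMin k (j + 1) B ^ 2 = ∑ i, (∑ l, B i l * x l) ^ 2 := by
    rw [hσ, Real.sq_sqrt (Finset.sum_nonneg fun _ _ => sq_nonneg _)]
  refine ⟨x, ?_, hsq.symm, hσ ▸ Real.sqrt_nonneg _, fun w => ?_⟩
  · rw [← show ∑ l, x l ^ 2 = 1 from hx]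
    simp [dotProduct, sq]
  · rcases eq_or_ne (w ⬝ᵥ w) 0 with h0 | h0
    · rw [h0, mul_zero]
      exact Finset.sum_nonneg fun _ _ => sq_nonneg _
    have hpos : 0 < w ⬝ᵥ w :=
      lt_of_le_of_ne (Finset.sum_nonneg fun _ _ => mul_self_nonneg _) h0.symm
    set c := (√(w ⬝ᵥ w))⁻¹ with hc
    have hc2 : c ^ 2 = (w ⬝ᵥ w)⁻¹ := by rw [hc, inv_pow, Real.sq_sqrt hpos.le]
    have hmem : c • w ∈ S := by
      simp only [hS, Set.mem_ofPred_eq, Pi.smul_apply, smul_eq_mul, mul_pow, hc2]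
      rw [← Finset.mul_sum, ← inv_mul_cancel₀ h0]
      simp [dotProduct, sq]
    have h1 := hmin hmem
    simp only [Set.mem_ofPred_eq] at h1
    rw [← hσ] at h1
    replace h1 := (Real.le_sqrt (by rw [hσ]; exact Real.sqrt_nonneg _)
      (Finset.sum_nonneg fun _ _ => sq_nonneg _)).1 h1
    have h2 : ∑ i, (∑ l, B i l * (c • w) l) ^ 2 = c ^ 2 * ∑ i, (∑ l, B i l * w l) ^ 2 := by
      rw [Finset.mul_sum]
      refine Finset.sum_congr rfl fun i _ => ?_
      rw [← mul_pow, Finset.mul_sum]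
      congr 1
      exact Finset.sum_congr rfl fun l _ => by rw [Pi.smul_apply, smul_eq_mul]; ring
    rw [h2, hc2] at h1
    calc _ ≤ (w ⬝ᵥ w)⁻¹ * (∑ i, (∑ l, B i l * w l) ^ 2) * (w ⬝ᵥ w) :=
          mul_le_mul_of_nonneg_right h1 hpos.le
      _ = _ := by field_simp

lemma measurableSet_isNearInverse {m k : ℕ} (δ r : ℝ) :
    MeasurableSet {p : (Fin m → Fin k → ℝ) × (Fin m → ℝ) | IsNearInverse δ r p.1 p.2} := by
  have hG : Continuous fun p : (Fin m → Fin k → ℝ) × (Fin m → ℝ) => rowGram p.1 :=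
    continuous_rowGram.comp continuous_fst
  have hdet : Measurable fun p : (Fin m → Fin k → ℝ) × (Fin m → ℝ) => (rowGram p.1).det :=
    measurable_det_rowGram.comp measurable_fst
  have hadj : Measurable fun p : (Fin m → Fin k → ℝ) × (Fin m → ℝ) =>
      (rowGram p.1).adjugate.mulVec p.2 :=
    (hG.matrix_adjugate.matrix_mulVec continuous_snd).measurable
  have hw : Measurable fun p : (Fin m → Fin k → ℝ) × (Fin m → ℝ) =>
      (rowGram p.1)⁻¹.mulVec p.2 := by
    simp_rw [Matrix.inv_def, Ring.inverse_eq_inv', Matrix.smul_mulVec]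
    exact hdet.inv.smul hadj
  have hdot : ∀ {f g : (Fin m → Fin k → ℝ) × (Fin m → ℝ) → Fin m → ℝ}, Measurable f →
      Measurable g → Measurable fun p => f p ⬝ᵥ g p := fun hf hg =>
    Finset.measurable_sum _ fun i _ =>
      ((measurable_pi_apply i).comp hf).mul ((measurable_pi_apply i).comp hg)
  exact (measurableSet_eq_fun hdet measurable_const).compl.inter
    ((measurableSet_le ((hdot hw hw).mul (hdot measurable_snd measurable_snd))
      (((hdot measurable_snd hw).pow_const 2).const_mul _)).inter
    (measurableSet_le (hdot measurable_snd measurable_snd) ((hdot measurable_snd hw).const_mul _)))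

lemma pi_isNearInverse_le {j d k : ℕ} (hk : k = j + d) {v : ℝ≥0} (hv : v ≠ 0)
    {δ r : ℝ} (hδ : 0 ≤ δ) (hr : 0 ≤ r) {z : Fin (j + 1) → ℝ} (hz : z ≠ 0) :
    (Measure.pi fun _ : Fin (j + 1) => gaussianPi (Fin k) v) {Y | IsNearInverse δ r Y z}
      ≤ ENNReal.ofReal ((2 * π * v) ^ (-((k : ℝ) / 2)) * (√π ^ j / Gamma ((j : ℝ) / 2 + 1) * δ ^ j)
          * (√π ^ d / Gamma ((d : ℝ) / 2 + 1) * r ^ d)) *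
        ENNReal.ofReal ((2 * v) ^ ((j : ℝ) / 2) * Gamma (((k : ℝ) + 1) / 2)
          / Gamma (((d : ℝ) + 1) / 2)) := by
  have hms : ∀ z : Fin (j + 1) → ℝ,
      MeasurableSet {Y : Fin (j + 1) → Fin k → ℝ | IsNearInverse δ r Y z} := fun z =>
    (measurable_id.prodMk measurable_const) (measurableSet_isNearInverse δ r)
  have hpos : 0 < z ⬝ᵥ z :=
    lt_of_le_of_ne (Finset.sum_nonneg fun _ _ => mul_self_nonneg _)
      fun h => hz (dotProduct_self_eq_zero.1 h.symm)
  set c := (√(z ⬝ᵥ z))⁻¹ with hc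
  have hc2 : c ^ 2 = (z ⬝ᵥ z)⁻¹ := by rw [hc, inv_pow, Real.sq_sqrt hpos.le]
  have hc0 : c ≠ 0 := by positivity
  obtain ⟨R, hR, hRz⟩ := exists_orthogonal_matrix_mulVec_eq_single (x := c • z) (by
    rw [smul_dotProduct, dotProduct_smul, smul_eq_mul, smul_eq_mul, ← mul_assoc, ← sq, hc2,
      inv_mul_cancel₀ hpos.ne'])
  have h1 : {Y : Fin (j + 1) → Fin k → ℝ | IsNearInverse δ r Y z}
      = (fun Y => Matrix.of.symm (R * Matrix.of Y)) ⁻¹'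
        {Y | IsNearInverse δ r Y (Pi.single 0 1)} := by
    ext Y
    rw [Set.mem_preimage, Set.mem_ofPred_eq, Set.mem_ofPred_eq, ← hRz, isNearInverse_mul hR,
      isNearInverse_smul hc0]
  rw [h1, (measurePreserving_mul_left_gaussianPi v hR).measure_preimage
    (hms _).nullMeasurableSet, ← lintegral_indicator_one (hms _),
    lintegral_pi_fin_succ _ (measurable_one.indicator (hms _))]
  have hjd : ((k : ℝ) - j + 1) / 2 = (d + 1) / 2 := by rw [hk]; push_cast; ring
  rw [← hjd, ← lintegral_sqrt_det_rowGram (by omega) hv,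
    ← lintegral_const_mul _ measurable_det_rowGram.sqrt.ennreal_ofReal]
  refine lintegral_mono_ae ?_
  filter_upwards [ae_det_rowGram_ne_zero (by omega) hv] with X hX
  refine le_trans (le_of_eq ?_) (gaussianPi_isNearInverse_cons_le hk hv hδ hr hX)
  have hcons : Measurable fun a : Fin k → ℝ => (Fin.cons a X : Fin (j + 1) → Fin k → ℝ) :=
    (measurePreserving_finCons (gaussianPi (Fin k) v)).measurable.comp
      (measurable_id.prodMk measurable_const)
  exact lintegral_indicator_one (hcons (hms _))

lemma cone_mul_sigmaMin_le {j d k : ℕ} (hk : k = j + d) (hd : d ≠ 0) {v : ℝ≥0} (hv : v ≠ 0)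
    {δ t : ℝ} (hδ : 0 ≤ δ) (ht : 0 ≤ t) :
    gaussianPi (Fin (j + 1)) v {z | ∑ i : Fin j, z i.succ ^ 2 ≤ δ ^ 2 * z 0 ^ 2} *
      (Measure.pi fun _ : Fin k => gaussianPi (Fin (j + 1)) v) {B | sigmaMin k (j + 1) B ≤ t}
      ≤ ENNReal.ofReal ((2 * π * v) ^ (-((k : ℝ) / 2)) * (√π ^ j / Gamma ((j : ℝ) / 2 + 1) * δ ^ j)
          * (√π ^ d / Gamma ((d : ℝ) / 2 + 1) * (√(1 + δ ^ 2) * t) ^ d)) *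
        ENNReal.ofReal ((2 * v) ^ ((j : ℝ) / 2) * Gamma (((k : ℝ) + 1) / 2)
          / Gamma (((d : ℝ) + 1) / 2)) := by
  set p := gaussianPi (Fin (j + 1)) v {z | ∑ i : Fin j, z i.succ ^ 2 ≤ δ ^ 2 * z 0 ^ 2}
  set r := √(1 + δ ^ 2) * t with hr
  set ν := Measure.pi fun _ : Fin (j + 1) => gaussianPi (Fin k) v
  set E := {p : (Fin (j + 1) → Fin k → ℝ) × (Fin (j + 1) → ℝ) | IsNearInverse δ r p.1 p.2}
  have hE : MeasurableSet E := measurableSet_isNearInverse δ r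
  set f : (Fin (j + 1) → Fin k → ℝ) → ℝ≥0∞ := fun Y =>
    gaussianPi (Fin (j + 1)) v (Prod.mk Y ⁻¹' E) with hf
  have hfm : Measurable f := measurable_measure_prodMk_left hE
  have h1 : (Measure.pi fun _ : Fin k => gaussianPi (Fin (j + 1)) v)
      {B | sigmaMin k (j + 1) B ≤ t} ≤ ν {Y | p ≤ f Y} := by
    have hT := measurePreserving_swap_pi_pi (ι := Fin k) (κ := Fin (j + 1)) (gaussianReal 0 v)
    rw [← hT.measure_preimage (measurableSet_le measurable_const hfm).nullMeasurableSet]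
    refine measure_mono_ae ?_
    filter_upwards [hT.quasiMeasurePreserving.ae
      (ae_det_rowGram_ne_zero (m := j + 1) (by omega) hv)] with B hdet hB
    obtain ⟨x, hx, hxq, hσ, hmin⟩ := exists_sigmaMin_eq B
    change p ≤ gaussianPi (Fin (j + 1)) v _
    refine (gaussianPi_cone_eq (v := v) (δ := δ) hx).ge.trans ?_
    refine measure_mono fun z hz => ?_
    have hvec : ∀ w : Fin (j + 1) → ℝ, Matrix.vecMul w (Matrix.of fun l i => B i l) ⬝ᵥ
        Matrix.vecMul w (Matrix.of fun l i => B i l) = ∑ i, (∑ l, B i l * w l) ^ 2 := fun w => by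
      simp [Matrix.vecMul, dotProduct, sq, mul_comm]
    refine isNearInverse_of_isMin (q := sigmaMin k (j + 1) B ^ 2) (t := t) hdet
      ((hvec x).trans hxq) (fun w => (hmin w).trans (hvec w).ge) (pow_le_pow_left₀ hσ hB 2) ?_ hz
    rw [hr, mul_pow, Real.sq_sqrt (by positivity)]
  calc _ ≤ p * ν {Y | p ≤ f Y} := mul_le_mul_right h1 _
    _ ≤ ∫⁻ Y, f Y ∂ν := mul_meas_ge_le_lintegral hfm p
    _ = ∫⁻ z, ν {Y | IsNearInverse δ r Y z} ∂(gaussianPi (Fin (j + 1)) v) := by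
        rw [← Measure.prod_apply hE, Measure.prod_apply_symm hE]
        rfl
    _ ≤ _ := by
        have h0 : ∀ᵐ z ∂(gaussianPi (Fin (j + 1)) v), z ≠ 0 := by
          rw [gaussianPi_eq_withDensity _ hv]
          refine (withDensity_absolutelyContinuous _ _).ae_le ?_
          exact compl_mem_ae_iff.2 (measure_singleton 0)
        refine (lintegral_mono_ae (h0.mono fun z hz =>
          pi_isNearInverse_le hk hv hδ (r := r) (by positivity) hz)).trans_eq ?_
        rw [lintegral_const, measure_univ, mul_one]

lemma sqrt_pow_eq_rpow {x : ℝ} (hx : 0 ≤ x) (n : ℕ) : √x ^ n = x ^ ((n : ℝ) / 2) := by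
  rw [Real.sqrt_eq_rpow, ← Real.rpow_natCast, ← Real.rpow_mul hx]
  congr 1
  ring

lemma pi_mul_rpow_identity {j d k : ℕ} (hk : k = j + d) {a : ℝ} (ha : 0 < a) :
    (π * a) ^ (-((k : ℝ) / 2)) * √π ^ d * a ^ ((j : ℝ) / 2) =
      (π * a) ^ (-(((j : ℝ) + 1) / 2)) * a ^ (((j : ℝ) + 1) / 2) * (√π * a ^ (-((d : ℝ) / 2))) := by
  have hpi := Real.pi_pos
  rw [sqrt_pow_eq_rpow hpi.le, Real.sqrt_eq_rpow, hk]
  simp only [Real.rpow_def_of_pos hpi, Real.rpow_def_of_pos ha, Real.rpow_def_of_pos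
    (mul_pos hpi ha), ← Real.exp_add, Real.log_mul hpi.ne' ha.ne']
  congr 1
  push_cast
  ring

lemma toReal_sigmaMin_le_mul {j d k : ℕ} (hk : k = j + d) (hd : d ≠ 0) {v : ℝ≥0} (hv : v ≠ 0)
    {δ t : ℝ} (hδ : 0 < δ) (ht : 0 ≤ t) :
    ((Measure.pi fun _ : Fin k => gaussianPi (Fin (j + 1)) v)
        {B | sigmaMin k (j + 1) B ≤ t}).toReal ≤
      2 * √π * (2 * v) ^ (-((d : ℝ) / 2)) * Gamma (((k : ℝ) + 1) / 2) /
        (d * Gamma (((j : ℝ) + 1) / 2) * Gamma ((d : ℝ) / 2) * Gamma (((d : ℝ) + 1) / 2)) * t ^ d *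
        (1 + δ ^ 2) ^ (((k : ℝ) + 1) / 2) := by
  have ha : (0 : ℝ) < 2 * v := by positivity
  have hd' : (0 : ℝ) < d := by positivity
  have hu : 0 < 1 + δ ^ 2 := by positivity
  have hgj := Gamma_pos_of_pos (s := (j : ℝ) / 2 + 1) (by positivity)
  have hgj' := Gamma_pos_of_pos (s := ((j : ℝ) + 1) / 2) (by positivity)
  have hgd := Gamma_pos_of_pos (s := (d : ℝ) / 2) (by positivity)
  have hgd' := Gamma_pos_of_pos (s := ((d : ℝ) + 1) / 2) (by positivity)
  have hgk := Gamma_pos_of_pos (s := ((k : ℝ) + 1) / 2) (by positivity)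
  have hpow := pi_mul_rpow_identity hk ha
  have hupow : √(1 + δ ^ 2) ^ d * (1 + δ ^ 2) ^ (((j : ℝ) + 1) / 2) =
      (1 + δ ^ 2) ^ (((k : ℝ) + 1) / 2) := by
    rw [sqrt_pow_eq_rpow hu.le, ← Real.rpow_add hu, hk]
    congr 1
    push_cast
    ring
  have hup : 0 < (1 + δ ^ 2) ^ (((j : ℝ) + 1) / 2) := Real.rpow_pos_of_pos hu _
  have hmain := (mul_le_mul_left (le_gaussianPi_cone hv hδ.le) _).trans
    (cone_mul_sigmaMin_le hk hd hv hδ.le ht)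
  rw [← ENNReal.ofReal_mul (by positivity), show 2 * π * (v : ℝ) = π * (2 * v) by ring] at hmain
  set a : ℝ := 2 * v
  set A := (π * a) ^ (-(((j : ℝ) + 1) / 2)) * (√π ^ j / Gamma ((j : ℝ) / 2 + 1) * δ ^ j) *
    (a / (1 + δ ^ 2)) ^ (((j : ℝ) + 1) / 2) * Gamma (((j : ℝ) + 1) / 2) with hA
  have hA0 : 0 < A := by positivity
  refine ENNReal.toReal_le_of_le_ofReal (by positivity) ?_
  rw [← ENNReal.mul_le_mul_iff_right (ENNReal.ofReal_pos.2 hA0).ne' ENNReal.ofReal_ne_top,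
    ← ENNReal.ofReal_mul hA0.le]
  refine hmain.trans_eq (congrArg _ ?_)
  rw [hA, Real.div_rpow ha.le hu.le, ← hupow, Gamma_add_one (s := (d : ℝ) / 2) (by positivity),
    mul_pow]
  generalize Gamma (((k : ℝ) + 1) / 2) = gk at *
  generalize Gamma (((j : ℝ) + 1) / 2) = gj at *
  generalize Gamma (((d : ℝ) + 1) / 2) = gd at *
  generalize Gamma ((d : ℝ) / 2) = gd2 at *
  field_simp
  linear_combination t ^ d * hpow

lemma toReal_sigmaMin_le {j d k : ℕ} (hk : k = j + d) (hd : d ≠ 0) {v : ℝ≥0} (hv : v ≠ 0)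
    {t : ℝ} (ht : 0 ≤ t) :
    ((Measure.pi fun _ : Fin k => gaussianPi (Fin (j + 1)) v)
        {B | sigmaMin k (j + 1) B ≤ t}).toReal ≤
      2 * √π * (2 * v) ^ (-((d : ℝ) / 2)) * Gamma (((k : ℝ) + 1) / 2) /
        (d * Gamma (((j : ℝ) + 1) / 2) * Gamma ((d : ℝ) / 2) * Gamma (((d : ℝ) + 1) / 2)) *
        t ^ d := by
  have hlim : Tendsto (fun δ : ℝ => (1 + δ ^ 2) ^ (((k : ℝ) + 1) / 2)) (𝓝[>] 0) (𝓝 1) := by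
    have hc : Continuous fun δ : ℝ => (1 + δ ^ 2) ^ (((k : ℝ) + 1) / 2) :=
      Continuous.rpow_const (by fun_prop) fun δ => Or.inl (by positivity)
    simpa using (hc.tendsto 0).mono_left nhdsWithin_le_nhds
  rw [← mul_one (_ * t ^ d)]
  refine ge_of_tendsto (hlim.const_mul _) ?_
  filter_upwards [self_mem_nhdsWithin] with δ hδ
  exact toReal_sigmaMin_le_mul hk hd hv hδ ht

/-- Non-asymptotic bound on the distribution of the least singular value of a
`k×m` random matrix `B` with i.i.d. `N(0,1/k)` entries (`k ≥ m ≥ 1`): for every `t > 0`,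
`P(σ_min(B) ≤ t) ≤ (2 k^{(k−m+1)/2} E_{k,m}/(k−m+1)) t^{k−m+1}`. -/
theorem stmt12 (k m : ℕ) (hm : 1 ≤ m) (hkm : m ≤ k) (t : ℝ) (ht : 0 < t) :
    ((Measure.pi fun _ : Fin k => Measure.pi fun _ : Fin m =>
        gaussianReal 0 (1 / (k : ℝ≥0))) {B | sigmaMin k m B ≤ t}).toReal
      ≤ (2 * (k : ℝ) ^ (((k : ℝ) - m + 1) / 2) * Ekm k m / ((k : ℝ) - m + 1)) *
          t ^ ((k : ℝ) - m + 1) := by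
  obtain ⟨j, rfl⟩ := Nat.exists_eq_add_of_le' hm
  obtain ⟨e, rfl⟩ := Nat.exists_eq_add_of_le hkm
  have hd : ((j + 1 + e : ℕ) : ℝ) - ((j + 1 : ℕ) : ℝ) + 1 = ((e + 1 : ℕ) : ℝ) := by
    push_cast
    ring
  have hd2 : ((j + 1 + e : ℕ) : ℝ) - ((j + 1 : ℕ) : ℝ) + 2 = ((e + 1 : ℕ) : ℝ) + 1 := by
    push_cast
    ring
  have hk : (0 : ℝ) < ((j + 1 + e : ℕ) : ℝ) := by positivity
  have hv : 1 / ((j + 1 + e : ℕ) : ℝ≥0) ≠ 0 := by positivity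
  refine (toReal_sigmaMin_le (j := j) (d := e + 1) (by omega) e.succ_ne_zero hv ht.le).trans_eq ?_
  have hcast : 2 * ((1 / ((j + 1 + e : ℕ) : ℝ≥0) : ℝ≥0) : ℝ) = 2 / ((j + 1 + e : ℕ) : ℝ) := by
    push_cast
    ring
  rw [Ekm, hd, hd2, Real.rpow_natCast, hcast, Real.div_rpow zero_le_two hk.le,
    Real.rpow_neg hk.le, Nat.cast_succ j]
  have hk' := (Real.rpow_pos_of_pos hk (((e + 1 : ℕ) : ℝ) / 2)).ne'
  field_simp
end
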